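/- arXiv:0711.3827 — 2 statements merged into one kernel-verified Lean document; each statement's English description precedes it below -/
import Mathlib

section
/- Fix an integer k ≥ 2. If r = r(n) satisfies r(n) / (n!/((n-2k)! · 2^k · k!))^{1/(k-1)} → 0 as n → ∞ (and r(n) ≥ 1), then the probability that a uniformly random r(n)-coloring of the edges of K_n contains a monochromatic k-matching tends to 1 as n → ∞. -/
open Finset Filter

open scoped Classical

noncomputable section

/-- A finset of edges of `K_n` forms a matching: all edges are proper (non-loop)
and no two distinct edges share a vertex. -/
def IsMatching {n : ℕ} (M : Finset (Sym2 (Fin n))) : Prop :=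
  (∀ e ∈ M, ¬ e.IsDiag) ∧
    ∀ e ∈ M, ∀ f ∈ M, e ≠ f → ∀ v : Fin n, v ∈ e → v ∉ f

/-- The finset of all `k`-matchings of `K_n`. -/
def matchings (n k : ℕ) : Finset (Finset (Sym2 (Fin n))) :=
  Finset.univ.filter fun M => M.card = k ∧ IsMatching M

/-- All edges in `M` receive the same color under the coloring `c`. -/
def Monochromatic {n r : ℕ} (c : Sym2 (Fin n) → Fin r)
    (M : Finset (Sym2 (Fin n))) : Prop :=
  ∃ col, ∀ e ∈ M, c e = col

/-- Distinct edges in `M` receive pairwise distinct colors under `c`. -/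
def Heterochromatic {n r : ℕ} (c : Sym2 (Fin n) → Fin r)
    (M : Finset (Sym2 (Fin n))) : Prop :=
  ∀ e ∈ M, ∀ f ∈ M, e ≠ f → c e ≠ c f

/-- Probability of an event `P` under a uniformly random `r`-coloring of the
edges of `K_n`. -/
def Pr (n r : ℕ) (P : (Sym2 (Fin n) → Fin r) → Prop) : ℚ :=
  ((Finset.univ.filter P).card : ℚ) / (Fintype.card (Sym2 (Fin n) → Fin r) : ℚ)

/-- Expected number of monochromatic `k`-matchings in a uniformly random
`r`-coloring of the edges of `K_n`. -/
def EXmono (n r k : ℕ) : ℚ :=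
  (∑ c : Sym2 (Fin n) → Fin r,
      (((matchings n k).filter fun M => Monochromatic c M).card : ℚ)) /
    (Fintype.card (Sym2 (Fin n) → Fin r) : ℚ)

/-- Expected number of heterochromatic `k`-matchings in a uniformly random
`r`-coloring of the edges of `K_n`. -/
def EYhet (n r k : ℕ) : ℚ :=
  (∑ c : Sym2 (Fin n) → Fin r,
      (((matchings n k).filter fun M => Heterochromatic c M).card : ℚ)) /
    (Fintype.card (Sym2 (Fin n) → Fin r) : ℚ)

/-- The vertex set `S` spans a monochromatic clique: all edges between distinct
vertices of `S` have one common color. -/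
def MonoClique {n r : ℕ} (c : Sym2 (Fin n) → Fin r) (S : Finset (Fin n)) : Prop :=
  ∃ col, ∀ u ∈ S, ∀ v ∈ S, u ≠ v → c s(u, v) = col

/-- The vertex set `S` spans a heterochromatic clique: distinct edges between
vertices of `S` have pairwise distinct colors. -/
def HeteroClique {n r : ℕ} (c : Sym2 (Fin n) → Fin r) (S : Finset (Fin n)) : Prop :=
  ∀ u ∈ S, ∀ v ∈ S, ∀ w ∈ S, ∀ x ∈ S,
    u ≠ v → w ≠ x → s(u, v) ≠ s(w, x) → c s(u, v) ≠ c s(w, x)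

/-- `T` is the edge set of a tree with vertex set `S`: it consists of
`S.card - 1` proper edges inside `S` and connects all vertices of `S`
(a connected graph on `|S|` vertices with `|S| - 1` edges is a tree). -/
def IsTreeOn {n : ℕ} (S : Finset (Fin n)) (T : Finset (Sym2 (Fin n))) : Prop :=
  T.card + 1 = S.card ∧ (∀ e ∈ T, ¬ e.IsDiag) ∧
    (∀ e ∈ T, ∀ v : Fin n, v ∈ e → v ∈ S) ∧
    ∀ u ∈ S, ∀ v ∈ S,
      (SimpleGraph.fromEdgeSet (↑T : Set (Sym2 (Fin n)))).Reachable u v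

/-- number of positions with color `a` -/
def cnt {s r : ℕ} (d : Fin s → Fin r) (a : Fin r) : ℝ := ∑ x, if d x = a then 1 else 0

lemma cnt_nonneg {s r : ℕ} (d : Fin s → Fin r) (a : Fin r) : 0 ≤ cnt d a :=
  Finset.sum_nonneg fun x _ => by split_ifs <;> norm_num

lemma cnt_cons {s r : ℕ} (x : Fin r) (d : Fin s → Fin r) (a : Fin r) :
    cnt (Fin.cons x d : Fin (s+1) → Fin r) a = (if x = a then 1 else 0) + cnt d a := by
  unfold cnt
  rw [Fin.sum_univ_succ]
  simp only [Fin.cons_zero, Fin.cons_succ]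

lemma sum_fn_succ {s r : ℕ} (F : (Fin (s+1) → Fin r) → ℝ) :
    ∑ d, F d = ∑ x : Fin r, ∑ d : Fin s → Fin r, F (Fin.cons x d : Fin (s+1) → Fin r) := by
  rw [← (Fin.consEquiv (fun _ : Fin (s+1) => Fin r)).sum_comp, Fintype.sum_prod_type]
  rfl

lemma M1 (s r : ℕ) (a : Fin r) :
    (r : ℝ) * ∑ d : Fin s → Fin r, cnt d a = s * (r:ℝ)^s := by
  induction s with
  | zero => simp [cnt]
  | succ s ih =>
    rw [sum_fn_succ]
    simp only [cnt_cons, Finset.sum_add_distrib, Finset.sum_const, Finset.card_univ,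
      Fintype.card_pi, Fintype.card_fin, nsmul_eq_mul, Finset.prod_const, mul_ite, mul_one, mul_zero,
      Finset.sum_ite_eq', Finset.mem_univ, if_true]
    push_cast
    rw [mul_add, ih]
    ring

lemma M2 (s r : ℕ) (a b : Fin r) :
    (r : ℝ)^2 * ∑ d : Fin s → Fin r, cnt d a * cnt d b =
      (r:ℝ)^s * ((if a = b then (s:ℝ) * r else 0) + s * (s - 1)) := by
  induction s with
  | zero => simp [cnt]
  | succ s ih =>
    rw [sum_fn_succ]
    have h : ∀ (x : Fin r) (d : Fin s → Fin r),
        cnt (Fin.cons x d : Fin (s+1) → Fin r) a * cnt (Fin.cons x d : Fin (s+1) → Fin r) b =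
        (if x = a then (if a = b then 1 else 0) else 0) + (if x = a then cnt d b else 0)
         + (if x = b then cnt d a else 0) + cnt d a * cnt d b := by
      intro x d
      rw [cnt_cons, cnt_cons]
      by_cases h1 : x = a
      · subst h1
        by_cases h2 : x = b
        · subst h2; simp; ring
        · simp [h2]; ring
      · by_cases h2 : x = b
        · subst h2; simp [h1]; ring
        · simp [h1, h2]
    simp only [h, Finset.sum_add_distrib]
    have e1 : ∑ x : Fin r, ∑ d : Fin s → Fin r, (if x = a then cnt d b else 0)
        = ∑ d : Fin s → Fin r, cnt d b := by
      rw [Finset.sum_comm]; simp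
    have e2 : ∑ x : Fin r, ∑ d : Fin s → Fin r, (if x = b then cnt d a else 0)
        = ∑ d : Fin s → Fin r, cnt d a := by
      rw [Finset.sum_comm]; simp
    rw [e1, e2]
    have e3 : ∑ x : Fin r, ∑ d : Fin s → Fin r, (if x = a then (if a = b then (1:ℝ) else 0) else 0)
        = (r:ℝ)^s * (if a = b then 1 else 0) := by
      rw [Finset.sum_comm]; simp
    rw [e3]
    simp only [Finset.sum_const, Finset.card_univ, Fintype.card_fin, nsmul_eq_mul]
    have A := M1 s r a
    have B := M1 s r b
    have : (r:ℝ)^2 * ((r:ℝ)^s * (if a = b then 1 else 0) + ∑ d : Fin s → Fin r, cnt d b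
       + ∑ d : Fin s → Fin r, cnt d a + r * ∑ d : Fin s → Fin r, cnt d a * cnt d b)
       = (r:ℝ)^2 * ((r:ℝ)^s * (if a = b then 1 else 0)) + r * (r * ∑ d : Fin s → Fin r, cnt d b)
       + r * (r * ∑ d : Fin s → Fin r, cnt d a)
       + r * ((r:ℝ)^2 * ∑ d : Fin s → Fin r, cnt d a * cnt d b) := by ring
    rw [this, A, B, ih]
    push_cast
    split_ifs <;> ring

/-- number of monochromatic transversals -/
def XX {k s r : ℕ} (d : Fin k → Fin s → Fin r) : ℝ := ∑ a : Fin r, ∏ i, cnt (d i) a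

lemma sum_prod_pow {k s r : ℕ} (g : (Fin s → Fin r) → ℝ) :
    ∑ d : Fin k → Fin s → Fin r, ∏ i, g (d i) = (∑ d, g d)^k := by
  rw [← Fintype.piFinset_univ, Finset.sum_prod_piFinset]
  simp

lemma sum_XX (k s r : ℕ) (hr : 0 < r) :
    ∑ d : Fin k → Fin s → Fin r, XX d = r * ((s:ℝ) / r * (r:ℝ)^s)^k := by
  have hr' : (r:ℝ) ≠ 0 := by positivity
  unfold XX
  rw [Finset.sum_comm]
  have : ∀ a : Fin r, ∑ d : Fin k → Fin s → Fin r, ∏ i, cnt (d i) a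
      = ((s:ℝ) / r * (r:ℝ)^s)^k := by
    intro a
    rw [sum_prod_pow (fun d => cnt d a)]
    congr 1
    have := M1 s r a
    field_simp
    linarith
  simp [this]

lemma sum_XX_sq (k s r : ℕ) (hr : 0 < r) (hs : 0 < s) :
    ∑ d : Fin k → Fin s → Fin r, (XX d)^2 ≤
      (((s:ℝ) / r)^2 * (r:ℝ)^s)^k * (r^2 + r * ((1 + (r:ℝ)/s)^k - 1)) := by
  have hr' : (0:ℝ) < r := by positivity
  have hs' : (0:ℝ) < s := by positivity
  have hs1 : (1:ℝ) ≤ s := by exact_mod_cast hs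
  have h0 : ∀ d : Fin k → Fin s → Fin r, (XX d)^2 =
      ∑ a : Fin r, ∑ b : Fin r, ∏ i, (cnt (d i) a * cnt (d i) b) := by
    intro d
    rw [sq, XX, Finset.sum_mul_sum]
    simp [Finset.prod_mul_distrib]
  have h1 : ∑ d : Fin k → Fin s → Fin r, (XX d)^2 =
      ∑ a : Fin r, ∑ b : Fin r, (∑ d : Fin s → Fin r, cnt d a * cnt d b)^k := by
    simp only [h0]
    rw [Finset.sum_comm]
    refine Finset.sum_congr rfl fun a _ => ?_
    rw [Finset.sum_comm]
    refine Finset.sum_congr rfl fun b _ => ?_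
    exact sum_prod_pow (fun d => cnt d a * cnt d b)
  rw [h1]
  have h2 : ∀ a b : Fin r, (∑ d : Fin s → Fin r, cnt d a * cnt d b)^k ≤
      (((s:ℝ) / r)^2 * (r:ℝ)^s)^k * (1 + if a = b then (1 + (r:ℝ)/s)^k - 1 else 0) := by
    intro a b
    have h3 : (1 + if a = b then (1 + (r:ℝ)/s)^k - 1 else 0) =
        (1 + if a = b then (r:ℝ)/s else 0)^k := by
      split_ifs <;> simp
    rw [h3, ← mul_pow]
    apply pow_le_pow_left₀
    · exact Finset.sum_nonneg fun d _ => mul_nonneg (cnt_nonneg _ _) (cnt_nonneg _ _)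
    have h4 := M2 s r a b
    have h5 : ∑ d : Fin s → Fin r, cnt d a * cnt d b =
      (r:ℝ)^s * ((if a = b then (s:ℝ) * r else 0) + s * (s - 1)) / (r:ℝ)^2 := by
      rw [eq_div_iff (by positivity), ← h4]; ring
    have h6 : ((s:ℝ) / r)^2 * (r:ℝ)^s * (1 + if a = b then (r:ℝ)/s else 0) =
      (r:ℝ)^s * ((if a = b then (s:ℝ) * r else 0) + s * s) / (r:ℝ)^2 := by
      split_ifs
      · field_simp; ring
      · field_simp; ring
    rw [h5, h6]
    gcongr
    linarith
  refine (Finset.sum_le_sum fun a _ => Finset.sum_le_sum fun b _ => h2 a b).trans ?_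
  simp only [← Finset.mul_sum, Finset.sum_add_distrib, Finset.sum_ite_eq, Finset.mem_univ, if_true,
    Finset.sum_const, Finset.card_univ, Fintype.card_fin, nsmul_eq_mul]
  apply le_of_eq
  ring

lemma core (k s r : ℕ) (hr : 0 < r) (hs : 0 < s) :
    (1:ℝ) / (1 + ((1 + (r:ℝ)/s)^k - 1) / r) * ∑ d : Fin k → Fin s → Fin r, (1:ℝ) ≤
    ∑ d : Fin k → Fin s → Fin r, (if XX d = 0 then (0:ℝ) else 1) := by
  have hr' : (0:ℝ) < r := by positivity
  have hs' : (0:ℝ) < s := by positivity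
  have hcs := Finset.sum_mul_sq_le_sq_mul_sq (Finset.univ : Finset (Fin k → Fin s → Fin r))
    (fun d => if XX d = 0 then (0:ℝ) else 1) XX
  have e1 : ∀ d : Fin k → Fin s → Fin r, (if XX d = 0 then (0:ℝ) else 1) * XX d = XX d := by
    intro d; split_ifs with h <;> simp [h]
  have e2 : ∀ d : Fin k → Fin s → Fin r, (if XX d = 0 then (0:ℝ) else 1)^2
     = (if XX d = 0 then (0:ℝ) else 1) := by
    intro d; split_ifs with h <;> simp
  simp only [e1, e2] at hcs
  rw [sum_XX k s r hr] at hcs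
  set P := ∑ d : Fin k → Fin s → Fin r, (if XX d = 0 then (0:ℝ) else 1) with hP
  have hP0 : 0 ≤ P := Finset.sum_nonneg fun d _ => by split_ifs <;> norm_num
  have h2 := hcs.trans (mul_le_mul_of_nonneg_left (sum_XX_sq k s r hr hs) hP0)
  have hone : (1:ℝ) ≤ (1 + (r:ℝ)/s)^k := one_le_pow₀ (by have : (0:ℝ) < r / s := by positivity
                                                         linarith)
  set δ := ((1 + (r:ℝ)/s)^k - 1) / r with hδ
  have hδ0 : 0 ≤ δ := div_nonneg (by linarith) hr'.le
  have hδr : (1 + (r:ℝ)/s)^k - 1 = δ * r := by rw [hδ]; field_simp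
  have hD : ∑ d : Fin k → Fin s → Fin r, (1:ℝ) = ((r:ℝ)^s)^k := by simp
  rw [hD]
  rw [hδr] at h2
  have h3 : ((((s:ℝ) / r)^2 * (r:ℝ)^s)^k * r^2) * ((r:ℝ)^s)^k ≤
     ((((s:ℝ) / r)^2 * (r:ℝ)^s)^k * r^2) * (P * (1 + δ)) := by
    calc _ = (r * ((s:ℝ) / r * (r:ℝ)^s)^k)^2 := by
            simp only [mul_pow]; ring
      _ ≤ _ := h2
      _ = _ := by ring
  have h4 := le_of_mul_le_mul_left h3 (by positivity)
  rw [one_div, inv_mul_le_iff₀ (by positivity)]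
  linarith

lemma delta_bound (k s r : ℕ) (hr : 0 < r) (hs : 0 < s) (hk : 1 ≤ k) :
    ((1 + (r:ℝ)/s)^k - 1) / r ≤ 2^k * (1 / s + (r:ℝ)^(k-1) / (s:ℝ)^k) := by
  have hr' : (0:ℝ) < r := by positivity
  have hs' : (0:ℝ) < s := by positivity
  have key : ∀ x : ℝ, 0 ≤ x → x ≤ 1 → ∀ k : ℕ, (1 + x)^k - 1 ≤ (2^k) * x := by
    intro x hx hx1 k
    induction k with
    | zero => simpa using hx
    | succ k ih =>
      have h1 : (1+x)^k ≤ 2^k := pow_le_pow_left₀ (by linarith) (by linarith) k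
      have h2 := mul_le_mul_of_nonneg_right h1 hx
      rw [pow_succ, pow_succ]
      linarith
  have t1 : 0 ≤ (r:ℝ)^(k-1) / (s:ℝ)^k := by positivity
  have t2 : (0:ℝ) ≤ 1 / s := by positivity
  have t3 : (0:ℝ) < 2^k := by positivity
  rcases le_total (r:ℝ) s with h | h
  · calc _ ≤ (2^k * ((r:ℝ)/s)) / r := by
          gcongr
          exact key _ (by positivity) (by rw [div_le_one hs']; exact h) k
      _ = 2^k * (1 / s) := by field_simp
      _ ≤ _ := by nlinarith
  · have h1 : 1 ≤ (r:ℝ)/s := by rw [le_div_iff₀ hs']; linarith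
    calc _ ≤ (2 * ((r:ℝ)/s))^k / r := by
          gcongr
          have : (1 + (r:ℝ)/s)^k ≤ (2 * ((r:ℝ)/s))^k :=
            pow_le_pow_left₀ (by linarith) (by linarith) k
          linarith
      _ = 2^k * ((r:ℝ)^(k-1) / (s:ℝ)^k) := by
          obtain ⟨j, rfl⟩ : ∃ j, k = j + 1 := ⟨k-1, by omega⟩
          simp only [Nat.add_sub_cancel, mul_pow, div_pow]
          field_simp
          try ring
      _ ≤ _ := by nlinarith

lemma restrict_sum {α β γ : Type} [Fintype α] [Fintype β] [Fintype γ] [Nonempty γ]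
    (φ : β → α) (hφ : Function.Injective φ) :
    ∃ K : ℝ, 0 < K ∧ ∀ F : (β → γ) → ℝ, ∑ c : α → γ, F (c ∘ φ) = K * ∑ d, F d := by
  let e : β ⊕ ((Set.range φ)ᶜ : Set α) ≃ α :=
    ((Equiv.ofInjective φ hφ).sumCongr (Equiv.refl _)).trans (Equiv.Set.sumCompl (Set.range φ))
  have he : ∀ b, e (Sum.inl b) = φ b := fun b => by simp [e]
  let E : (α → γ) ≃ (β → γ) × (((Set.range φ)ᶜ : Set α) → γ) :=
    (Equiv.arrowCongr e.symm (Equiv.refl γ)).trans (Equiv.sumArrowEquivProdArrow _ _ _)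
  have hE : ∀ c, (E c).1 = c ∘ φ := by
    intro c; funext b; simp [E, Equiv.sumArrowEquivProdArrow, he]
  refine ⟨Fintype.card (((Set.range φ)ᶜ : Set α) → γ), by exact_mod_cast Fintype.card_pos, ?_⟩
  intro F
  simp only [← hE]
  rw [E.sum_comp (fun p => F p.1), Fintype.sum_prod_type, Finset.mul_sum]
  simp

lemma exists_of_XX {k s r : ℕ} (d : Fin k → Fin s → Fin r) (h : XX d ≠ 0) :
    ∃ a, ∃ x : Fin k → Fin s, ∀ i, d i (x i) = a := by
  obtain ⟨a, -, ha⟩ := Finset.exists_ne_zero_of_sum_ne_zero h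
  refine ⟨a, ?_⟩
  rw [Finset.prod_ne_zero_iff] at ha
  have : ∀ i, ∃ x, d i x = a := by
    intro i
    obtain ⟨x, -, hx⟩ := Finset.exists_ne_zero_of_sum_ne_zero (ha i (Finset.mem_univ i))
    exact ⟨x, by by_contra hh; simp [hh] at hx⟩
  choose x hx using this
  exact ⟨x, hx⟩

lemma exists_phi (n k m : ℕ) (h : 2 * k * m ≤ n) :
    ∃ φ : Fin k × Fin (m * m) → Sym2 (Fin n), Function.Injective φ ∧
      (∀ p, ¬ (φ p).IsDiag) ∧ ∀ p q v, p.1 ≠ q.1 → v ∈ φ p → v ∉ φ q := by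
  have : Nonempty (Fin k × (Fin m ⊕ Fin m) ↪ Fin n) := by
    apply Function.Embedding.nonempty_of_card_le
    simp
    nlinarith
  obtain ⟨ψ⟩ := this
  let q := (finProdFinEquiv (m := m) (n := m)).symm
  refine ⟨fun p => s(ψ (p.1, Sum.inl (q p.2).1), ψ (p.1, Sum.inr (q p.2).2)), ?_, ?_, ?_⟩
  · rintro ⟨i, x⟩ ⟨j, y⟩ hxy
    simp only [Sym2.eq_iff, ψ.injective.eq_iff, Prod.mk.injEq, Sum.inl.injEq, Sum.inr.injEq,
      reduceCtorEq, and_false, or_false] at hxy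
    obtain ⟨⟨h1, h2⟩, -, h3⟩ := hxy
    have : q x = q y := Prod.ext h2 h3
    rw [h1, q.injective this]
  · rintro ⟨i, x⟩
    simp
  · rintro ⟨i, x⟩ ⟨j, y⟩ v hij h1 h2
    simp only [Sym2.mem_iff] at h1 h2
    rcases h1 with rfl | rfl <;> rcases h2 with h2 | h2 <;>
      · have := congrArg Prod.fst (ψ.injective h2)
        exact hij this

lemma prob_bound (n k m r : ℕ) (hk : 1 ≤ k) (hm : 0 < m) (hr : 0 < r) (h : 2 * k * m ≤ n) :
    (1:ℝ) / (1 + 2^k * (1 / ((m:ℝ)*m) + (r:ℝ)^(k-1) / ((m:ℝ)*m)^k)) ≤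
     ((Pr n r (fun c => ∃ M ∈ matchings n k, Monochromatic c M) : ℚ) : ℝ) := by
  have hphi := exists_phi n k m h
  have hs : 0 < m * m := by positivity
  obtain ⟨s, hsdef⟩ : ∃ s, s = m * m := ⟨_, rfl⟩
  rw [← hsdef] at hphi hs
  obtain ⟨φ, hφ, hd, hdisj⟩ := hphi
  have : Nonempty (Fin r) := ⟨⟨0, hr⟩⟩
  obtain ⟨K, hK, hF⟩ := restrict_sum (γ := Fin r) φ hφ
  have hcore := core k s r hr hs
  have hδ := delta_bound k s r hr hs hk
  have hsR : (s:ℝ) = (m:ℝ) * m := by rw [hsdef]; push_cast; rfl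
  have hcur : ∀ G : (Fin k → Fin s → Fin r) → ℝ,
      ∑ c : Sym2 (Fin n) → Fin r, G (Function.curry (c ∘ φ)) = K * ∑ d, G d := by
    intro G
    have h1 := hF (fun d => G (Function.curry d))
    rw [← (Equiv.curry (Fin k) (Fin s) (Fin r)).sum_comp]
    convert h1
    rfl
  have hone := hcur (fun _ => 1)
  have hind := hcur (fun d => if XX d = 0 then (0:ℝ) else 1)
  have hle : ∑ c : Sym2 (Fin n) → Fin r, (if XX (Function.curry (c ∘ φ)) = 0 then (0:ℝ) else 1)
      ≤ ((Finset.univ.filter (fun c : Sym2 (Fin n) → Fin r =>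
          ∃ M ∈ matchings n k, Monochromatic c M)).card : ℝ) := by
    rw [Finset.card_filter]
    push_cast
    refine Finset.sum_le_sum fun c _ => ?_
    by_cases hX : XX (Function.curry (c ∘ φ)) = 0
    · rw [if_pos hX]; split_ifs <;> norm_num
    · rw [if_neg hX, if_pos]
      obtain ⟨a, x, hx⟩ := exists_of_XX _ hX
      refine ⟨Finset.univ.image (fun i => φ (i, x i)), ?_, a, ?_⟩
      · simp only [matchings, Finset.mem_filter, Finset.mem_univ, true_and]
        refine ⟨?_, ?_, ?_⟩
        · rw [Finset.card_image_of_injective]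
          · simp
          · intro i j hij
            exact congrArg Prod.fst (hφ hij)
        · intro e he
          simp only [Finset.mem_image, Finset.mem_univ, true_and] at he
          obtain ⟨i, rfl⟩ := he
          exact hd _
        · intro e he f hf hef v
          simp only [Finset.mem_image, Finset.mem_univ, true_and] at he hf
          obtain ⟨i, rfl⟩ := he
          obtain ⟨j, rfl⟩ := hf
          apply hdisj
          rintro hij
          simp only at hij
          subst hij
          exact hef rfl
      · intro e he
        simp only [Finset.mem_image, Finset.mem_univ, true_and] at he
        obtain ⟨i, rfl⟩ := he
        exact hx i
  have hcard : (Fintype.card (Sym2 (Fin n) → Fin r) : ℝ) =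
      K * ∑ d : Fin k → Fin s → Fin r, (1:ℝ) := by
    rw [← hone]; simp [Finset.card_univ]
  have hpos : (0:ℝ) < Fintype.card (Sym2 (Fin n) → Fin r) := by exact_mod_cast Fintype.card_pos
  unfold Pr
  push_cast
  rw [hsR] at hδ
  rw [le_div_iff₀ (by exact_mod_cast hpos)]
  refine le_trans ?_ (hle.trans (le_of_eq ?_))
  swap
  · congr!
  rw [hind]
  have hr' : (0:ℝ) < r := by positivity
  have hm' : (0:ℝ) < m := by positivity
  have hδ0 : 0 ≤ ((1 + (r:ℝ)/(m*m))^k - 1) / r := by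
    apply div_nonneg _ hr'.le
    have : (1:ℝ) ≤ (1 + (r:ℝ)/(m*m))^k := one_le_pow₀ (by
      have : (0:ℝ) < r / (m*m) := by positivity
      linarith)
    linarith
  rw [hsR] at hcore
  have hfin : (1:ℝ) / (1 + 2^k * (1 / ((m:ℝ)*m) + (r:ℝ)^(k-1) / ((m:ℝ)*m)^k)) ≤
      1 / (1 + ((1 + (r:ℝ)/(m*m))^k - 1) / r) := by
    apply one_div_le_one_div_of_le <;> linarith
  have hS0 : 0 ≤ ∑ d : Fin k → Fin s → Fin r, (1:ℝ) := by positivity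
  calc _ = K * ((1:ℝ) / (1 + 2^k * (1 / ((m:ℝ)*m) + (r:ℝ)^(k-1) / ((m:ℝ)*m)^k)) *
        ∑ d : Fin k → Fin s → Fin r, (1:ℝ)) := by
        rw [show ((Fintype.card (Sym2 (Fin n) → Fin r) : ℕ) : ℝ) = _ from hcard] <;> ring
    _ ≤ K * (1 / (1 + ((1 + (r:ℝ)/(m*m))^k - 1) / r) * ∑ d : Fin k → Fin s → Fin r, (1:ℝ)) := by
        gcongr
    _ ≤ _ := by
        apply mul_le_mul_of_nonneg_left hcore hK.le

lemma Pr_le_one (n r : ℕ) (P : (Sym2 (Fin n) → Fin r) → Prop) : ((Pr n r P : ℚ) : ℝ) ≤ 1 := by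
  have : Pr n r P ≤ 1 := by
    unfold Pr
    apply div_le_one_of_le₀
    · exact_mod_cast Finset.card_le_univ _
    · positivity
  exact_mod_cast this

lemma Q_bound (n k m : ℕ) (hn : 2 * k ≤ n) (hm : n ≤ 4 * k * m) :
    (n.factorial : ℝ) / (((n - 2 * k).factorial : ℝ) * 2 ^ k * (k.factorial : ℝ)) ≤
      (16 * (k:ℝ)^2)^k * ((m:ℝ)*m)^k := by
  have h1 : (n.factorial : ℝ) = (n - 2*k).factorial * n.descFactorial (2*k) := by
    exact_mod_cast (Nat.factorial_mul_descFactorial hn).symm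
  have h2 : (n.descFactorial (2*k) : ℝ) ≤ (n:ℝ)^(2*k) := by
    exact_mod_cast Nat.descFactorial_le_pow n (2*k)
  have h3 : (n:ℝ) ≤ 4 * k * m := by exact_mod_cast hm
  have h4 : (1:ℝ) ≤ 2^k * k.factorial := by
    have : 1 ≤ 2^k * k.factorial := Nat.succ_le_of_lt (by positivity)
    exact_mod_cast this
  have hp : (0:ℝ) < (n - 2*k).factorial := by positivity
  calc _ = (n.descFactorial (2*k) : ℝ) / (2^k * k.factorial) := by
        rw [h1]; field_simp
    _ ≤ n.descFactorial (2*k) := div_le_self (by positivity) h4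
    _ ≤ (n:ℝ)^(2*k) := h2
    _ ≤ (4 * k * m)^(2*k) := by gcongr
    _ = _ := by rw [pow_mul, ← mul_pow]; congr 1; ring

/-- for fixed `k ≥ 2`, if `r(n) ≥ 1` and
`r(n) / (n!/((n-2k)! 2^k k!))^(1/(k-1)) → 0`, then the probability of
containing a monochromatic `k`-matching tends to `1`. -/
theorem mono_matching_below_threshold (k : ℕ) (hk : 2 ≤ k) (r : ℕ → ℕ)
    (hr1 : ∀ n, 1 ≤ r n)
    (hr : Tendsto
      (fun n => (r n : ℝ) /
        ((n.factorial : ℝ) /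
            (((n - 2 * k).factorial : ℝ) * 2 ^ k * (k.factorial : ℝ))) ^
          ((1 : ℝ) / ((k : ℝ) - 1)))
      atTop (nhds 0)) :
    Tendsto
      (fun n =>
        ((Pr n (r n) (fun c => ∃ M ∈ matchings n k, Monochromatic c M) : ℚ) : ℝ))
      atTop (nhds 1) := by
  have hk1 : (0:ℝ) < (k:ℝ) - 1 := by
    have : (2:ℝ) ≤ k := by exact_mod_cast hk
    linarith
  set Q : ℕ → ℝ := fun n => (n.factorial : ℝ) /
            (((n - 2 * k).factorial : ℝ) * 2 ^ k * (k.factorial : ℝ)) with hQ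
  have hQ0 : ∀ n, 0 < Q n := fun n => by simp only [hQ]; positivity
  have hpow : Tendsto (fun n => (r n : ℝ)^(k-1) / Q n) atTop (nhds 0) := by
    have h := hr.pow (k-1)
    rw [zero_pow (by omega)] at h
    refine h.congr fun n => ?_
    rw [div_pow]
    congr 1
    change (Q n ^ ((1:ℝ) / ((k:ℝ) - 1)))^(k-1) = Q n
    rw [← Real.rpow_natCast, ← Real.rpow_mul (hQ0 n).le]
    rw [Nat.cast_sub (by omega)]
    push_cast
    rw [one_div, inv_mul_cancel₀ hk1.ne', Real.rpow_one]
  have hmt : Tendsto (fun n : ℕ => n / (2*k)) atTop atTop :=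
    Nat.tendsto_div_const_atTop (by omega)
  have hmr : Tendsto (fun n : ℕ => ((n / (2*k) : ℕ) : ℝ)) atTop atTop :=
    tendsto_natCast_atTop_atTop.comp hmt
  have hinv : Tendsto (fun n : ℕ => 1 / (((n / (2*k) : ℕ) : ℝ) * ((n / (2*k) : ℕ) : ℝ)))
      atTop (nhds 0) := by
    simp only [one_div]
    exact (hmr.atTop_mul_atTop₀ hmr).inv_tendsto_atTop
  have hlow : Tendsto (fun n : ℕ => (1:ℝ) / (1 + 2^k * (1 / (((n / (2*k) : ℕ) : ℝ) *
      ((n / (2*k) : ℕ) : ℝ)) + (16 * (k:ℝ)^2)^k * ((r n : ℝ)^(k-1) / Q n)))) atTop (nhds 1) := by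
    have h1 : Tendsto (fun n : ℕ => 1 + 2^k * (1 / (((n / (2*k) : ℕ) : ℝ) *
      ((n / (2*k) : ℕ) : ℝ)) + (16 * (k:ℝ)^2)^k * ((r n : ℝ)^(k-1) / Q n))) atTop (nhds 1) := by
      have := ((hinv.add (hpow.const_mul ((16 * (k:ℝ)^2)^k))).const_mul ((2:ℝ)^k)).const_add 1
      simpa using this
    simpa using h1.inv₀ one_ne_zero
  refine tendsto_of_tendsto_of_tendsto_of_le_of_le' hlow tendsto_const_nhds ?_
    (Eventually.of_forall fun n => Pr_le_one _ _ _)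
  filter_upwards [eventually_ge_atTop (2*k)] with n hn
  have hm : 0 < n / (2*k) := Nat.div_pos hn (by omega)
  have hle : 2 * k * (n / (2*k)) ≤ n := Nat.mul_div_le n (2*k)
  have hup : n ≤ 4 * k * (n / (2*k)) := by
    have := Nat.lt_mul_div_succ n (show 0 < 2*k by omega)
    nlinarith
  refine le_trans ?_ (prob_bound n k (n/(2*k)) (r n) (by omega) hm (hr1 n) hle)
  have hB := Q_bound n k (n/(2*k)) hn hup
  set m := n / (2*k)
  have hm' : (0:ℝ) < m := by exact_mod_cast hm
  have hkey : (r n:ℝ)^(k-1) / ((m:ℝ)*m)^k ≤ (16 * (k:ℝ)^2)^k * ((r n : ℝ)^(k-1) / Q n) := by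
    rw [← mul_div_assoc, div_le_div_iff₀ (by positivity) (hQ0 n)]
    calc _ ≤ (r n:ℝ)^(k-1) * ((16 * (k:ℝ)^2)^k * ((m:ℝ)*m)^k) :=
          mul_le_mul_of_nonneg_left hB (by positivity)
      _ = _ := by ring
  apply one_div_le_one_div_of_le (by positivity)
  gcongr

end
end

section
/- Let n be even. If the edges of K_n are independently uniformly colored with r = r(n) ≥ n/c colors for a constant c < e, then the probability that there exists a monochromatic perfect matching tends to 0 as n → ∞. -/
open Finset Filter

open scoped Classical

noncomputable section

/-- Matchings covering exactly the vertex set `S`. -/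
def covers {n : ℕ} (S : Finset (Fin n)) : Finset (Finset (Sym2 (Fin n))) :=
  Finset.univ.filter fun M => IsMatching M ∧ ∀ v, v ∈ S ↔ ∃ e ∈ M, v ∈ e

/-- Number of perfect matchings. -/
def pmCount : ℕ → ℕ
  | 0 => 1
  | k + 1 => (2 * k + 1) * pmCount k

lemma covers_card {n : ℕ} (k : ℕ) : ∀ S : Finset (Fin n), S.card = 2 * k →
    (covers S).card ≤ pmCount k := by
  induction k with
  | zero =>
    intro S hS
    have hS0 : S = ∅ := by simpa using hS
    subst hS0
    have : covers (∅ : Finset (Fin n)) ⊆ {∅} := by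
      intro M hM
      simp only [covers, mem_filter, mem_univ, true_and] at hM
      rw [Finset.mem_singleton, Finset.eq_empty_iff_forall_notMem]
      intro e he
      induction e using Sym2.ind with
      | _ x y =>
        have := (hM.2 x).2 ⟨_, he, Sym2.mem_mk_left x y⟩
        simp at this
    calc _ ≤ _ := card_le_card this
      _ = pmCount 0 := by simp [pmCount]
  | succ k ih =>
    intro S hS
    obtain ⟨v, hv⟩ : S.Nonempty := by
      rw [← Finset.card_pos]; omega
    have hsub : covers S ⊆ (S.erase v).biUnion fun w =>
        (covers ((S.erase v).erase w)).image fun M => insert s(v, w) M := by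
      intro M hM
      simp only [covers, mem_filter, mem_univ, true_and] at hM
      obtain ⟨⟨hd, hm⟩, hc⟩ := hM
      obtain ⟨e, he, hve⟩ := (hc v).1 hv
      obtain ⟨w, rfl⟩ := Sym2.mem_iff_exists.1 hve
      have hvw : v ≠ w := by
        have := hd _ he
        simpa using this
      have hw : w ∈ S := (hc w).2 ⟨_, he, Sym2.mem_mk_right v w⟩
      rw [mem_biUnion]
      refine ⟨w, mem_erase.2 ⟨hvw.symm, hw⟩, ?_⟩
      rw [mem_image]
      refine ⟨M.erase s(v, w), ?_, insert_erase he⟩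
      simp only [covers, mem_filter, mem_univ, true_and]
      refine ⟨⟨fun e h => hd e (mem_of_mem_erase h), fun e h f h' =>
        hm e (mem_of_mem_erase h) f (mem_of_mem_erase h')⟩, ?_⟩
      intro x
      simp only [mem_erase]
      constructor
      · rintro ⟨hxw, hxv, hx⟩
        obtain ⟨f, hf, hxf⟩ := (hc x).1 hx
        refine ⟨f, ⟨?_, hf⟩, hxf⟩
        rintro rfl
        rcases Sym2.mem_iff.1 hxf with h | h
        · exact hxv h
        · exact hxw h
      · rintro ⟨f, ⟨hne, hf⟩, hxf⟩
        have h := hm f hf _ he hne x hxf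
        rw [Sym2.mem_iff] at h
        push Not at h
        exact ⟨h.2, h.1, (hc x).2 ⟨f, hf, hxf⟩⟩
    have hcard : (S.erase v).card = 2 * k + 1 := by
      rw [card_erase_of_mem hv]; omega
    calc _ ≤ _ := card_le_card hsub
      _ ≤ ∑ w ∈ S.erase v, pmCount k := by
        refine card_biUnion_le.trans (sum_le_sum fun w hw => card_image_le.trans (ih _ ?_))
        rw [card_erase_of_mem hw]; omega
      _ = pmCount (k + 1) := by simp [hcard, pmCount]

lemma matchings_card (m : ℕ) : (matchings (2 * m) m).card ≤ pmCount m := by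
  refine le_trans (card_le_card ?_) (covers_card m (univ : Finset (Fin (2 * m))) (by simp))
  intro M hM
  simp only [matchings, covers, mem_filter, mem_univ, true_and] at hM ⊢
  obtain ⟨hk, hd, hm⟩ := hM
  refine ⟨⟨hd, hm⟩, ?_⟩
  have hcard : (M.biUnion fun e => e.toFinset).card = 2 * m := by
    rw [card_biUnion]
    · rw [sum_congr rfl (g := fun _ => 2), sum_const, hk, smul_eq_mul, mul_comm]
      intro e he
      exact Sym2.card_toFinset_of_not_isDiag e (hd e he)
    · intro e he f hf hne
      simp only [Function.onFun]
      rw [Finset.disjoint_left]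
      intro v hv hv'
      exact hm e he f hf hne v (Sym2.mem_toFinset.1 hv) (Sym2.mem_toFinset.1 hv')
  have huniv : (M.biUnion fun e => e.toFinset) = univ := by
    rw [← Finset.card_eq_iff_eq_univ, hcard]; simp
  intro v
  have : v ∈ (M.biUnion fun e => e.toFinset) := by rw [huniv]; exact mem_univ v
  simpa using this

lemma count_fixed {n r : ℕ} (M : Finset (Sym2 (Fin n))) (col : Fin r) :
    (univ.filter fun f : Sym2 (Fin n) → Fin r => ∀ e ∈ M, f e = col).card * r ^ M.card
      = Fintype.card (Sym2 (Fin n) → Fin r) := by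
  have h1 : (univ.filter fun f : Sym2 (Fin n) → Fin r => ∀ e ∈ M, f e = col)
      = Fintype.piFinset (fun e => if e ∈ M then {col} else univ) := by
    ext f
    simp only [mem_filter, mem_univ, true_and, Fintype.mem_piFinset]
    refine forall_congr' fun e => ?_
    by_cases h : e ∈ M <;> simp [h]
  have h2 : r ^ M.card = ∏ e : Sym2 (Fin n), if e ∈ M then r else 1 := by
    simp
  rw [h1, Fintype.card_piFinset, h2, ← prod_mul_distrib, Fintype.card_pi]
  refine prod_congr rfl fun e _ => ?_
  by_cases h : e ∈ M <;> simp [h]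

lemma pr_bound (m r : ℕ) :
    (univ.filter fun f : Sym2 (Fin (2 * m)) → Fin r =>
      ∃ M ∈ matchings (2 * m) m, Monochromatic f M).card * r ^ m
      ≤ pmCount m * r * Fintype.card (Sym2 (Fin (2 * m)) → Fin r) := by
  have hsub : (univ.filter fun f : Sym2 (Fin (2 * m)) → Fin r =>
      ∃ M ∈ matchings (2 * m) m, Monochromatic f M) ⊆
      (matchings (2 * m) m ×ˢ (univ : Finset (Fin r))).biUnion fun p =>
        univ.filter fun f : Sym2 (Fin (2 * m)) → Fin r => ∀ e ∈ p.1, f e = p.2 := by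
    intro f hf
    simp only [mem_filter, mem_univ, true_and] at hf
    obtain ⟨M, hM, col, hcol⟩ := hf
    simp only [mem_biUnion, mem_filter, mem_univ, true_and, mem_product, and_true]
    exact ⟨(M, col), hM, hcol⟩
  calc _ ≤ (∑ p ∈ matchings (2 * m) m ×ˢ (univ : Finset (Fin r)),
        (univ.filter fun f : Sym2 (Fin (2 * m)) → Fin r => ∀ e ∈ p.1, f e = p.2).card) * r ^ m :=
        Nat.mul_le_mul_right _ ((card_le_card hsub).trans card_biUnion_le)
    _ = ∑ p ∈ matchings (2 * m) m ×ˢ (univ : Finset (Fin r)),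
        Fintype.card (Sym2 (Fin (2 * m)) → Fin r) := by
        rw [sum_mul]
        refine sum_congr rfl fun p hp => ?_
        have : p.1.card = m := by
          have := (mem_product.1 hp).1
          simp only [matchings, mem_filter] at this
          exact this.2.1
        rw [← count_fixed p.1 p.2, this]
    _ = (matchings (2 * m) m).card * r * Fintype.card (Sym2 (Fin (2 * m)) → Fin r) := by
        simp
    _ ≤ _ := by gcongr; exact matchings_card m

lemma analytic (c : ℝ) (hc0 : 0 < c) (hc : c < Real.exp 1) :
    Tendsto (fun m : ℕ => (pmCount m : ℝ) * (c / (2 * m)) ^ m * (2 * m / c)) atTop (nhds 0) := by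
  apply Summable.tendsto_atTop_zero
  have hpm : ∀ m, (0 : ℝ) < pmCount m := by
    intro m
    induction m with
    | zero => simp [pmCount]
    | succ k ih => rw [pmCount]; push_cast; positivity
  have hl : c * (2 * (Real.exp 1)⁻¹ ) / 2 < 1 := by
    have := Real.exp_pos 1
    field_simp
    linarith
  refine summable_of_ratio_test_tendsto_lt_one (l := c * (2 * (Real.exp 1)⁻¹) / 2) hl ?_ ?_
  · filter_upwards [eventually_gt_atTop 0] with m hm
    have : (0 : ℝ) < m := by exact_mod_cast hm
    have := hpm m
    positivity
  · have h1 : Tendsto (fun m : ℕ => c * ((2 + 1 / (m : ℝ)) * ((1 + 1 / (m : ℝ)) ^ m)⁻¹) / 2) atTop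
        (nhds (c * (2 * (Real.exp 1)⁻¹) / 2)) := by
      have ha : Tendsto (fun m : ℕ => (2 + 1 / (m : ℝ))) atTop (nhds 2) := by
        simpa using (tendsto_const_nhds (x := (2 : ℝ))).add tendsto_one_div_atTop_nhds_zero_nat
      have hb := (Real.tendsto_one_add_div_pow_exp 1).inv₀ (Real.exp_pos 1).ne'
      exact ((ha.mul hb).const_mul c).div_const 2
    refine h1.congr' ?_
    filter_upwards [eventually_gt_atTop 0] with m hm
    have h0 : (0 : ℝ) < m := by exact_mod_cast hm
    have := hpm m
    have h3 : (1 + 1 / (m : ℝ)) = (m + 1) / m := by field_simp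
    rw [Real.norm_of_nonneg (by have := hpm (m + 1); positivity),
      Real.norm_of_nonneg (by positivity), h3, pmCount]
    push_cast
    simp only [div_pow, mul_pow, pow_succ]
    field_simp

lemma arith (k : ℕ) (A R N q p : ℝ) (hq : 0 < q) (hm : q ≤ R) (hN : 0 < N) (hp : 0 ≤ p)
    (hb' : A * R ^ (k + 1) ≤ p * R * N) : A ≤ p * q⁻¹ ^ (k + 1) * q * N := by
  have hR : 0 < R := hq.trans_le hm
  have h5 : A * R ^ k ≤ p * N := by
    rw [pow_succ] at hb'
    have : (A * R ^ k) * R ≤ (p * N) * R := by linarith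
    exact le_of_mul_le_mul_right this hR
  have h6 : A ≤ p * N / R ^ k := by rwa [le_div_iff₀ (by positivity)]
  have h7 : p * N / R ^ k ≤ p * N / q ^ k := by gcongr
  have h8 : p * q⁻¹ ^ (k + 1) * q * N = p * N / q ^ k := by
    rw [pow_succ, inv_pow]; field_simp
  rw [h8]; exact h6.trans h7

/-- for `n = 2m` even, if `r(n) ≥ n/c` with a constant `c < e`,
then the probability that a monochromatic perfect matching exists tends to
`0`. -/
theorem no_mono_perfect_matching (r : ℕ → ℕ) (c : ℝ) (hc0 : 0 < c)
    (hc : c < Real.exp 1)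
    (hr : ∀ᶠ m in atTop, ((2 * m : ℕ) : ℝ) / c ≤ (r (2 * m) : ℝ)) :
    Tendsto
      (fun m =>
        ((Pr (2 * m) (r (2 * m))
            (fun f => ∃ M ∈ matchings (2 * m) m, Monochromatic f M) : ℚ) : ℝ))
      atTop (nhds 0) := by
  have hlim := analytic c hc0 hc
  refine squeeze_zero' (Eventually.of_forall fun m => ?_) ?_ hlim
  · have : (0 : ℚ) ≤ Pr (2 * m) (r (2 * m))
        (fun f => ∃ M ∈ matchings (2 * m) m, Monochromatic f M) := by
      unfold Pr; positivity
    exact_mod_cast this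
  · filter_upwards [hr, eventually_gt_atTop 0] with m hm hm0
    have h0 : (0 : ℝ) < m := by exact_mod_cast hm0
    push_cast at hm
    have hq : 0 < 2 * (m : ℝ) / c := by positivity
    have hR : (0 : ℝ) < r (2 * m) := hq.trans_le hm
    have hb := pr_bound m (r (2 * m))
    have hb' : ((univ.filter fun f : Sym2 (Fin (2 * m)) → Fin (r (2 * m)) =>
      ∃ M ∈ matchings (2 * m) m, Monochromatic f M).card : ℝ) * (r (2 * m) : ℝ) ^ m
      ≤ pmCount m * (r (2 * m) : ℝ) *
        (Fintype.card (Sym2 (Fin (2 * m)) → Fin (r (2 * m))) : ℝ) := by exact_mod_cast hb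
    have hN : (0 : ℝ) < (Fintype.card (Sym2 (Fin (2 * m)) → Fin (r (2 * m))) : ℝ) := by
      have : 0 < r (2 * m) := by exact_mod_cast hR
      rw [Fintype.card_fun, Fintype.card_fin]
      push_cast
      positivity
    unfold Pr
    rw [Rat.cast_div, Rat.cast_natCast, Rat.cast_natCast, div_le_iff₀ hN]
    obtain ⟨k, rfl⟩ : ∃ k, m = k + 1 := ⟨m - 1, by omega⟩
    have e1 : c / (2 * ((k + 1 : ℕ) : ℝ)) = (2 * ((k + 1 : ℕ) : ℝ) / c)⁻¹ := by rw [inv_div]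
    rw [e1]
    refine arith k _ (r (2 * (k + 1)) : ℝ) _ _ _ hq (by exact_mod_cast hm) hN (by positivity) ?_
    convert hb'
    rfl

end
end
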